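/- For every natural number n and every finite binary word w: b(1^{3n+2}·0·w) = 1^{3n+2}·0·w, c(1^{3n+1}·0·w) = 1^{3n+1}·0·w, and d(1^{3n}·0·w) = 1^{3n}·0·w. In other words, the word 1^{3n+2}0 is strongly fixed by b, the word 1^{3n+1}0 is strongly fixed by c, and the word 1^{3n}0 is strongly fixed by d. -/

import Mathlib

/-- Generator `a` of the Grigorchuk group acting on finite binary words. -/
def grigA : List Bool → List Bool
  | [] => []
  | x :: w => (!x) :: w

mutual
  /-- Generator `b` of the Grigorchuk group acting on finite binary words. -/
  def grigB : List Bool → List Bool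
    | [] => []
    | false :: w => false :: grigA w
    | true :: w => true :: grigC w
  /-- Generator `c` of the Grigorchuk group acting on finite binary words. -/
  def grigC : List Bool → List Bool
    | [] => []
    | false :: w => false :: grigA w
    | true :: w => true :: grigD w
  /-- Generator `d` of the Grigorchuk group acting on finite binary words. -/
  def grigD : List Bool → List Bool
    | [] => []
    | false :: w => false :: w
    | true :: w => true :: grigB w
end

/-- For every `n` and every word `w`, the words `1^{3n+2}·0·w`,
`1^{3n+1}·0·w` and `1^{3n}·0·w` are fixed by `b`, `c` and `d`
respectively; i.e. `1^{3n+2}0` is strongly fixed by `b`, `1^{3n+1}0` is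
strongly fixed by `c`, and `1^{3n}0` is strongly fixed by `d`. -/
theorem grig_strongly_fixed_words (n : ℕ) (w : List Bool) :
    grigB (List.replicate (3 * n + 2) true ++ false :: w)
        = List.replicate (3 * n + 2) true ++ false :: w ∧
    grigC (List.replicate (3 * n + 1) true ++ false :: w)
        = List.replicate (3 * n + 1) true ++ false :: w ∧
    grigD (List.replicate (3 * n) true ++ false :: w)
        = List.replicate (3 * n) true ++ false :: w := by
  induction n with
  | zero => simp [List.replicate_succ, grigB, grigC, grigD]
  | succ n ih =>
    simpa [Nat.mul_succ, List.replicate_succ, grigB, grigC, grigD] using ih
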